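/- Let a, b : ℝ → ℝ be C¹ with a(t) < b(t), let w : ℝ → ℝ be C¹, let e : ℝ → ℝ be C², set γ(c) := e(c) − c·e'(c), and fix constants β > 0, ξ > 0, D ≥ 0, κ ≥ 0, θ₀ ∈ (−π/2, π/2), γ_SL, γ_SG ∈ ℝ. Let h, c : ℝ × ℝ → ℝ and λ : ℝ → ℝ be sufficiently smooth, with h(a(t), t) = w(a(t)), h(b(t), t) = w(b(t)) for all t. Set Q := √(1 + h_x²), v_n := h_t/Q, H := −h_{xx}/Q³. Suppose that for every t: (i) for all x ∈ [a(t), b(t)], (β/Q)·h_t = −γ(c)·H − κ·(h·cos θ₀ + x·sin θ₀) + λ(t); (ii) for all x ∈ [a(t), b(t)], c_t − v_n·∂_x(c·h_x/Q) = (D/Q)·∂_x(c_x/Q), with boundary conditions D·c_x + c·(1 + h_x·w_x)·b'(t) = 0 at x = b(t) and D·c_x + c·(1 + h_x·w_x)·a'(t) = 0 at x = a(t); (iii) ξ·b'(t) = −γ(c(b(t),t))·(1 + h_x·w_x)/Q|_{x=b(t)} − (γ_SL − γ_SG)·√(1 + w_x²)|_{x=b(t)} and ξ·a'(t) = γ(c(a(t),t))·(1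 + h_x·w_x)/Q|_{x=a(t)} + (γ_SL − γ_SG)·√(1 + w_x²)|_{x=a(t)}; (iv) the volume ∫_{a(t)}^{b(t)} (h − w) dx is constant in t. Define the total free energy F(t) := ∫_{a(t)}^{b(t)} e(c)·√(1 + h_x²) dx + (γ_SL − γ_SG)·∫_{a(t)}^{b(t)} √(1 + w_x²) dx + κ·∫_{a(t)}^{b(t)} ∫_{w(x)}^{h(x,t)} (y·cos θ₀ + x·sin θ₀) dy dx. Then for every t: dF/dt = −β·∫_{a(t)}^{b(t)} h_t²/√(1 + h_x²) dx − D·∫_{a(t)}^{b(t)} e''(c)·c_x²/√(1 + h_x²) dx − ξ·(a'(t)² + b'(t)²), i.e. dF/dt = −2Q(t) where Q(t) is the Rayleigh dissipation functional. -/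

import Mathlib

open intervalIntegral Real

/-- partial derivative in the space variable `x` -/
noncomputable def px1 (f : ℝ → ℝ → ℝ) (x t : ℝ) : ℝ := deriv (fun x' => f x' t) x

/-- partial derivative in the time variable `t` -/
noncomputable def pt1 (f : ℝ → ℝ → ℝ) (x t : ℝ) : ℝ := deriv (fun t' => f x t') t

/-- second partial derivative in `x` -/
noncomputable def pxx1 (f : ℝ → ℝ → ℝ) (x t : ℝ) : ℝ := deriv (fun x' => px1 f x' t) x

/-- the arclength element `Q = √(1 + h_x²)` -/
noncomputable def Qarc (h : ℝ → ℝ → ℝ) (x t : ℝ) : ℝ := Real.sqrt (1 + px1 h x t ^ 2)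

/-- the curvature `H = −h_xx/(1+h_x²)^{3/2}` -/
noncomputable def curv (h : ℝ → ℝ → ℝ) (x t : ℝ) : ℝ := -pxx1 h x t / Qarc h x t ^ 3

theorem leib_aux (f ft : ℝ → ℝ → ℝ)
    (hf : Continuous (fun p : ℝ × ℝ => f p.1 p.2))
    (hft : Continuous (fun p : ℝ × ℝ => ft p.1 p.2))
    (hd : ∀ x t, HasDerivAt (fun s => f x s) (ft x t) t) (u v t : ℝ) :
    HasDerivAt (fun s => ∫ x in u..v, f x s) (∫ x in u..v, ft x t) t := by
  obtain ⟨C, hC⟩ := ((isCompact_uIcc (a := u) (b := v)).prod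
    (isCompact_Icc (a := t - 1) (b := t + 1))).exists_bound_of_continuousOn hft.continuousOn
  refine (intervalIntegral.hasDerivAt_integral_of_dominated_loc_of_deriv_le
    (F := fun s x => f x s) (F' := fun s x => ft x s) (bound := fun _ => C)
    (s := Set.Icc (t - 1) (t + 1))
    (Icc_mem_nhds (by linarith) (by linarith)) ?_ ?_ ?_ ?_ ?_ ?_).2
  · refine Filter.Eventually.of_forall fun s => Continuous.aestronglyMeasurable ?_
    exact hf.comp (by fun_prop : Continuous fun x : ℝ => (x, s))
  · exact (hf.comp (by fun_prop : Continuous fun x : ℝ => (x, t))).intervalIntegrable _ _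
  · exact (hft.comp (by fun_prop : Continuous fun x : ℝ => (x, t))).aestronglyMeasurable
  · refine Filter.Eventually.of_forall fun x hx s hs => ?_
    exact hC (x, s) ⟨Set.uIoc_subset_uIcc hx, hs⟩
  · exact intervalIntegrable_const
  · exact Filter.Eventually.of_forall fun x hx s hs => hd x s

theorem leib_one (f ft : ℝ → ℝ → ℝ)
    (hf : Continuous (fun p : ℝ × ℝ => f p.1 p.2))
    (hft : Continuous (fun p : ℝ × ℝ => ft p.1 p.2))
    (hd : ∀ x t, HasDerivAt (fun s => f x s) (ft x t) t) (b : ℝ → ℝ) (b' t : ℝ)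
    (hb : HasDerivAt b b' t) :
    HasDerivAt (fun s => ∫ x in (0:ℝ)..b s, f x s)
      ((∫ x in (0:ℝ)..b t, ft x t) + f (b t) t * b') t := by
  have hc2 : Continuous (fun p : ℝ × ℝ => ∫ x in (0:ℝ)..p.2, ft x p.1) :=
    intervalIntegral.continuous_parametric_primitive_of_continuous (f := fun s x => ft x s)
      (hft.comp continuous_swap)
  have key := hasStrictFDerivAt_uncurry_coprod (𝕜 := ℝ) (u := (b t, t))
    (f := fun u s => ∫ x in (0:ℝ)..u, f x s)
    (f₁ := fun u s => ContinuousLinearMap.toSpanSingleton ℝ (f u s))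
    (f₂ := fun u s => ContinuousLinearMap.toSpanSingleton ℝ (∫ x in (0:ℝ)..u, ft x s))
    (Filter.Eventually.of_forall fun p => ?_) (Filter.Eventually.of_forall fun p => ?_) ?_ ?_
  · have h2 := key.hasFDerivAt.comp_hasDerivAt t (f := fun s => (b s, s))
      (hb.prodMk (hasDerivAt_id t))
    refine HasDerivAt.congr_deriv h2 ?_
    simp [Function.HasUncurry.uncurry]
    ring
  · have hcx : Continuous (fun x => f x p.2) :=
      hf.comp (by fun_prop : Continuous fun x : ℝ => (x, p.2))
    exact (intervalIntegral.integral_hasDerivAt_right (hcx.intervalIntegrable _ _)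
      (hcx.stronglyMeasurableAtFilter _ _) hcx.continuousAt).hasFDerivAt
  · exact (leib_aux f ft hf hft hd 0 p.1 p.2).hasFDerivAt
  · exact ((ContinuousLinearMap.toSpanSingletonCLE (𝕜 := ℝ) (E := ℝ)).continuous.comp
      hf).continuousAt
  · exact ((ContinuousLinearMap.toSpanSingletonCLE (𝕜 := ℝ) (E := ℝ)).continuous.comp
      (hc2.comp continuous_swap)).continuousAt

theorem leib_two (f ft : ℝ → ℝ → ℝ)
    (hf : Continuous (fun p : ℝ × ℝ => f p.1 p.2))
    (hft : Continuous (fun p : ℝ × ℝ => ft p.1 p.2))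
    (hd : ∀ x t, HasDerivAt (fun s => f x s) (ft x t) t) (a b : ℝ → ℝ) (a' b' t : ℝ)
    (ha : HasDerivAt a a' t) (hb : HasDerivAt b b' t) :
    HasDerivAt (fun s => ∫ x in a s..b s, f x s)
      ((∫ x in a t..b t, ft x t) + f (b t) t * b' - f (a t) t * a') t := by
  have h1 : ∀ (g : ℝ → ℝ → ℝ), Continuous (fun p : ℝ × ℝ => g p.1 p.2) → ∀ u v s : ℝ,
      (∫ x in u..v, g x s) = (∫ x in (0:ℝ)..v, g x s) - ∫ x in (0:ℝ)..u, g x s := by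
    intro g hg u v s
    have hcx : Continuous (fun x => g x s) :=
      hg.comp (by fun_prop : Continuous fun x : ℝ => (x, s))
    rw [intervalIntegral.integral_interval_sub_left] <;> exact hcx.intervalIntegrable _ _
  have h2 := (leib_one f ft hf hft hd b b' t hb).sub (leib_one f ft hf hft hd a a' t ha)
  have h3 : (fun s => ∫ x in a s..b s, f x s)
      = fun s => (∫ x in (0:ℝ)..b s, f x s) - ∫ x in (0:ℝ)..a s, f x s := by
    funext s; exact h1 f hf _ _ _
  rw [h3, h1 ft hft]
  exact HasDerivAt.congr_deriv h2 (by ring)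

/-- joint smoothness -/
abbrev Sm (f : ℝ → ℝ → ℝ) : Prop := ContDiff ℝ (⊤ : ℕ∞) (fun p : ℝ × ℝ => f p.1 p.2)

theorem Sm.hx {f : ℝ → ℝ → ℝ} (hf : Sm f) (x t : ℝ) :
    HasDerivAt (fun x' => f x' t) (fderiv ℝ (fun p : ℝ × ℝ => f p.1 p.2) (x, t) (1, 0)) x := by
  have h := (hf.differentiable (by simp) (x, t)).hasFDerivAt.comp_hasDerivAt x
    (f := fun x' => (x', t)) ((hasDerivAt_id x).prodMk (hasDerivAt_const x t))
  exact h

theorem Sm.ht {f : ℝ → ℝ → ℝ} (hf : Sm f) (x t : ℝ) :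
    HasDerivAt (fun t' => f x t') (fderiv ℝ (fun p : ℝ × ℝ => f p.1 p.2) (x, t) (0, 1)) t := by
  have h := (hf.differentiable (by simp) (x, t)).hasFDerivAt.comp_hasDerivAt t
    (f := fun t' => (x, t')) ((hasDerivAt_const t x).prodMk (hasDerivAt_id t))
  exact h

theorem Sm.px1_eq {f : ℝ → ℝ → ℝ} (hf : Sm f) (x t : ℝ) :
    px1 f x t = fderiv ℝ (fun p : ℝ × ℝ => f p.1 p.2) (x, t) (1, 0) := (hf.hx x t).deriv

theorem Sm.pt1_eq {f : ℝ → ℝ → ℝ} (hf : Sm f) (x t : ℝ) :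
    pt1 f x t = fderiv ℝ (fun p : ℝ × ℝ => f p.1 p.2) (x, t) (0, 1) := (hf.ht x t).deriv

theorem Sm.hasX {f : ℝ → ℝ → ℝ} (hf : Sm f) (x t : ℝ) :
    HasDerivAt (fun x' => f x' t) (px1 f x t) x := by
  rw [hf.px1_eq]; exact hf.hx x t

theorem Sm.hasT {f : ℝ → ℝ → ℝ} (hf : Sm f) (x t : ℝ) :
    HasDerivAt (fun t' => f x t') (pt1 f x t) t := by
  rw [hf.pt1_eq]; exact hf.ht x t

theorem Sm.px {f : ℝ → ℝ → ℝ} (hf : Sm f) : Sm (px1 f) := by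
  have : (fun p : ℝ × ℝ => px1 f p.1 p.2)
      = fun p => fderiv ℝ (fun p : ℝ × ℝ => f p.1 p.2) p (1, 0) := by
    funext p; exact hf.px1_eq _ _
  unfold Sm
  rw [this]
  exact (hf.fderiv_right (m := ((⊤ : ℕ∞) : WithTop ℕ∞)) (by simp)).clm_apply contDiff_const

theorem Sm.pt {f : ℝ → ℝ → ℝ} (hf : Sm f) : Sm (pt1 f) := by
  have : (fun p : ℝ × ℝ => pt1 f p.1 p.2)
      = fun p => fderiv ℝ (fun p : ℝ × ℝ => f p.1 p.2) p (0, 1) := by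
    funext p; exact hf.pt1_eq _ _
  unfold Sm
  rw [this]
  exact (hf.fderiv_right (m := ((⊤ : ℕ∞) : WithTop ℕ∞)) (by simp)).clm_apply contDiff_const

theorem Sm.symm {f : ℝ → ℝ → ℝ} (hf : Sm f) (x t : ℝ) :
    pt1 (px1 f) x t = px1 (pt1 f) x t := by
  have e1 : (fun p : ℝ × ℝ => px1 f p.1 p.2)
      = fun p => fderiv ℝ (fun p : ℝ × ℝ => f p.1 p.2) p (1, 0) := by
    funext p; exact hf.px1_eq _ _
  have e2 : (fun p : ℝ × ℝ => pt1 f p.1 p.2)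
      = fun p => fderiv ℝ (fun p : ℝ × ℝ => f p.1 p.2) p (0, 1) := by
    funext p; exact hf.pt1_eq _ _
  have hd : DifferentiableAt ℝ (fderiv ℝ (fun p : ℝ × ℝ => f p.1 p.2)) (x, t) :=
    (hf.fderiv_right (m := ((⊤ : ℕ∞) : WithTop ℕ∞)) (by simp)).differentiable (by simp) _
  have hs : IsSymmSndFDerivAt ℝ (fun p : ℝ × ℝ => f p.1 p.2) (x, t) :=
    hf.contDiffAt.isSymmSndFDerivAt (by simp; exact WithTop.coe_le_coe.2 le_top)
  rw [hf.px.pt1_eq, hf.pt.px1_eq, e1, e2]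
  rw [fderiv_clm_apply hd (differentiableAt_const _), fderiv_clm_apply hd (differentiableAt_const _)]
  simpa using hs.eq (0, 1) (1, 0)

theorem Qarc_pos (h : ℝ → ℝ → ℝ) (x t : ℝ) : 0 < Qarc h x t := by
  unfold Qarc; positivity

theorem Qarc_sq (h : ℝ → ℝ → ℝ) (x t : ℝ) : Qarc h x t ^ 2 = 1 + px1 h x t ^ 2 := by
  unfold Qarc; exact Real.sq_sqrt (by positivity)

theorem Sm.Q {h : ℝ → ℝ → ℝ} (hh : Sm h) : Sm (Qarc h) := by
  have := hh.px
  unfold Sm Qarc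
  exact ContDiff.sqrt (contDiff_const.add (this.pow 2)) (fun p => by positivity)

theorem Q_x {h : ℝ → ℝ → ℝ} (hh : Sm h) (x t : ℝ) :
    HasDerivAt (fun x' => Qarc h x' t) (px1 h x t * pxx1 h x t / Qarc h x t) x := by
  have h1 := (((hh.px.hasX x t).pow 2).const_add 1).sqrt (by simp only [Pi.pow_apply]; positivity)
  refine HasDerivAt.congr_deriv h1 ?_
  have : Real.sqrt (1 + px1 h x t ^ 2) ≠ 0 := by positivity
  change _ = px1 h x t * px1 (px1 h) x t / Real.sqrt (1 + px1 h x t ^ 2)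
  simp
  field_simp

theorem Q_t {h : ℝ → ℝ → ℝ} (hh : Sm h) (x t : ℝ) :
    HasDerivAt (fun t' => Qarc h x t') (px1 h x t * px1 (pt1 h) x t / Qarc h x t) t := by
  have h1 := (((hh.px.hasT x t).pow 2).const_add 1).sqrt (by simp only [Pi.pow_apply]; positivity)
  refine HasDerivAt.congr_deriv h1 ?_
  have : Real.sqrt (1 + px1 h x t ^ 2) ≠ 0 := by positivity
  rw [hh.symm]
  change _ = px1 h x t * px1 (pt1 h) x t / Real.sqrt (1 + px1 h x t ^ 2)
  simp
  field_simp

/-- derivative of the height at a moving end point -/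
theorem Sm.pin {h : ℝ → ℝ → ℝ} (hh : Sm h) (w b : ℝ → ℝ) (hw : Differentiable ℝ w)
    (hb : Differentiable ℝ b) (hpin : ∀ t, h (b t) t = w (b t)) (t : ℝ) :
    pt1 h (b t) t = (deriv w (b t) - px1 h (b t) t) * deriv b t := by
  have h1 := (hh.differentiable (by simp) (b t, t)).hasFDerivAt.comp_hasDerivAt t
    (f := fun s => (b s, s)) ((hb t).hasDerivAt.prodMk (hasDerivAt_id t))
  have h2 := (hw (b t)).hasDerivAt.comp t (hb t).hasDerivAt
  have h3 : ((fun p : ℝ × ℝ => h p.1 p.2) ∘ fun s => (b s, s)) = w ∘ b := by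
    funext s; exact hpin s
  rw [h3] at h1
  have h4 := h1.unique h2
  have h5 : ((deriv b t, 1) : ℝ × ℝ) = deriv b t • ((1, 0) : ℝ × ℝ) + (0, 1) := by simp
  rw [h5, map_add, map_smul, ← hh.px1_eq, ← hh.pt1_eq, smul_eq_mul] at h4
  linarith

/-- energy dissipation law `dF/dt = −2Q` for the full 2D governing system
(eq_full) on an inclined textured substrate, derived via Onsager's principle. -/
theorem energy_dissipation_law
    (a b w lam : ℝ → ℝ) (h c : ℝ → ℝ → ℝ) (e : ℝ → ℝ)
    (β ξ D κ θ₀ γSL γSG : ℝ)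
    (hβ : 0 < β) (hξ : 0 < ξ) (hD : 0 ≤ D) (hκ : 0 ≤ κ)
    (hθ : -(π / 2) < θ₀ ∧ θ₀ < π / 2)
    (ha : ContDiff ℝ 1 a) (hb : ContDiff ℝ 1 b) (hab : ∀ t, a t < b t)
    (hw : ContDiff ℝ 1 w) (he : ContDiff ℝ 2 e) (hlam : Continuous lam)
    (hh : ContDiff ℝ (⊤ : ℕ∞) (fun p : ℝ × ℝ => h p.1 p.2))
    (hc : ContDiff ℝ (⊤ : ℕ∞) (fun p : ℝ × ℝ => c p.1 p.2))
    (hpin : ∀ t, h (a t) t = w (a t) ∧ h (b t) t = w (b t))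
    -- (i) motion of the capillary curve
    (hmot : ∀ t, ∀ x ∈ Set.Icc (a t) (b t),
      (β / Qarc h x t) * pt1 h x t
        = -(e (c x t) - c x t * deriv e (c x t)) * curv h x t
          - κ * (h x t * Real.cos θ₀ + x * Real.sin θ₀) + lam t)
    -- (ii) surfactant transport with Robin boundary conditions
    (heq : ∀ t, ∀ x ∈ Set.Icc (a t) (b t),
      pt1 c x t
          - (pt1 h x t / Qarc h x t) *
              px1 (fun x t => c x t * px1 h x t / Qarc h x t) x t
        = (D / Qarc h x t) * px1 (fun x t => px1 c x t / Qarc h x t) x t)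
    (hbcb : ∀ t, D * px1 c (b t) t
        + c (b t) t * (1 + px1 h (b t) t * deriv w (b t)) * deriv b t = 0)
    (hbca : ∀ t, D * px1 c (a t) t
        + c (a t) t * (1 + px1 h (a t) t * deriv w (a t)) * deriv a t = 0)
    -- (iii) contact line dynamics
    (hclb : ∀ t, ξ * deriv b t
        = -(e (c (b t) t) - c (b t) t * deriv e (c (b t) t))
              * (1 + px1 h (b t) t * deriv w (b t)) / Qarc h (b t) t
          - (γSL - γSG) * Real.sqrt (1 + deriv w (b t) ^ 2))
    (hcla : ∀ t, ξ * deriv a t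
        = (e (c (a t) t) - c (a t) t * deriv e (c (a t) t))
              * (1 + px1 h (a t) t * deriv w (a t)) / Qarc h (a t) t
          + (γSL - γSG) * Real.sqrt (1 + deriv w (a t) ^ 2))
    -- (iv) volume constraint
    (hvol : ∀ t₁ t₂ : ℝ,
      (∫ x in a t₁..b t₁, (h x t₁ - w x)) = ∫ x in a t₂..b t₂, (h x t₂ - w x)) :
    ∀ t : ℝ,
      HasDerivAt
        (fun s =>
          (∫ x in a s..b s, e (c x s) * Real.sqrt (1 + px1 h x s ^ 2))
            + (γSL - γSG) * (∫ x in a s..b s, Real.sqrt (1 + deriv w x ^ 2))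
            + κ * (∫ x in a s..b s,
                ∫ y in w x..h x s, (y * Real.cos θ₀ + x * Real.sin θ₀)))
        (-(β * ∫ x in a t..b t, pt1 h x t ^ 2 / Real.sqrt (1 + px1 h x t ^ 2))
          - D * (∫ x in a t..b t,
              deriv (deriv e) (c x t) * px1 c x t ^ 2 / Real.sqrt (1 + px1 h x t ^ 2))
          - ξ * (deriv a t ^ 2 + deriv b t ^ 2)) t := by
  intro t
  have hh' : Sm h := hh
  have hc' : Sm c := hc
  have hwd : Differentiable ℝ w := hw.differentiable (by simp)
  have had : Differentiable ℝ a := ha.differentiable (by simp)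
  have hbd : Differentiable ℝ b := hb.differentiable (by simp)
  have hed : Differentiable ℝ e := he.differentiable (by simp)
  have he1 : ContDiff ℝ 1 (deriv e) := ContDiff.deriv' (n := 1) (by norm_num; exact he)
  have he1d : Differentiable ℝ (deriv e) := he1.differentiable (by simp)
  have he1c : Continuous (deriv e) := he1.continuous
  have he2c : Continuous (deriv (deriv e)) := he1.continuous_deriv (by simp)
  have hec : Continuous e := he.continuous
  have hwc : Continuous w := hw.continuous
  have hdwc : Continuous (deriv w) := hw.continuous_deriv (by simp)
  -- continuity of everything, jointly
  have ch : Continuous (fun p : ℝ × ℝ => h p.1 p.2) := hh.continuous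
  have cc : Continuous (fun p : ℝ × ℝ => c p.1 p.2) := hc.continuous
  have chx : Continuous (fun p : ℝ × ℝ => px1 h p.1 p.2) := hh'.px.continuous
  have cht : Continuous (fun p : ℝ × ℝ => pt1 h p.1 p.2) := hh'.pt.continuous
  have chxx : Continuous (fun p : ℝ × ℝ => pxx1 h p.1 p.2) := hh'.px.px.continuous
  have chtx : Continuous (fun p : ℝ × ℝ => px1 (pt1 h) p.1 p.2) := hh'.pt.px.continuous
  have ccx : Continuous (fun p : ℝ × ℝ => px1 c p.1 p.2) := hc'.px.continuous
  have cct : Continuous (fun p : ℝ × ℝ => pt1 c p.1 p.2) := hc'.pt.continuous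
  have cQ : Continuous (fun p : ℝ × ℝ => Qarc h p.1 p.2) := hh'.Q.continuous
  have hQ0 : ∀ x t, Qarc h x t ≠ 0 := fun x t => (Qarc_pos h x t).ne'
  have sl : ∀ {f : ℝ × ℝ → ℝ}, Continuous f → Continuous (fun x => f (x, t)) :=
    fun hf => hf.comp (by fun_prop)
  -- the three Leibniz rules
  set f1 : ℝ → ℝ → ℝ := fun x t => deriv e (c x t) * pt1 c x t * Qarc h x t
    + e (c x t) * (px1 h x t * px1 (pt1 h) x t / Qarc h x t) with hf1
  have cf1 : Continuous (fun p : ℝ × ℝ => f1 p.1 p.2) := by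
    simp only [hf1]
    exact (((he1c.comp cc).mul cct).mul cQ).add ((hec.comp cc).mul
      ((chx.mul chtx).div cQ (fun p => hQ0 _ _)))
  have L1 := leib_two (fun x s => e (c x s) * Qarc h x s) f1
    ((hec.comp cc).mul cQ) cf1
    (fun x s => HasDerivAt.congr_deriv
      (((hed _).hasDerivAt.comp s (hc'.hasT x s)).mul (Q_t hh' x s)) (by simp [hf1]))
    a b (deriv a t) (deriv b t) t (had t).hasDerivAt (hbd t).hasDerivAt
  have L2 := leib_two (fun x s => Real.sqrt (1 + deriv w x ^ 2)) (fun _ _ => 0)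
    (by fun_prop) (by fun_prop) (fun x s => hasDerivAt_const _ _)
    a b (deriv a t) (deriv b t) t (had t).hasDerivAt (hbd t).hasDerivAt
  set f3 : ℝ → ℝ → ℝ :=
    fun x t => (h x t * Real.cos θ₀ + x * Real.sin θ₀) * pt1 h x t with hf3
  have cf3 : Continuous (fun p : ℝ × ℝ => f3 p.1 p.2) := by
    simp only [hf3]; fun_prop
  have L3 := leib_two (fun x s => (h x s ^ 2 - w x ^ 2) / 2 * Real.cos θ₀
      + (h x s - w x) * (x * Real.sin θ₀)) f3
    (by fun_prop) cf3
    (fun x s => HasDerivAt.congr_deriv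
      ((((((hh'.hasT x s).pow 2).sub_const (w x ^ 2)).div_const 2).mul_const _).add
        (((hh'.hasT x s).sub_const (w x)).mul_const (x * Real.sin θ₀)))
      (by simp [hf3]; ring))
    a b (deriv a t) (deriv b t) t (had t).hasDerivAt (hbd t).hasDerivAt
  have L4 := leib_two (fun x s => h x s - w x) (pt1 h)
    (by fun_prop) cht (fun x s => (hh'.hasT x s).sub_const _)
    a b (deriv a t) (deriv b t) t (had t).hasDerivAt (hbd t).hasDerivAt
  have hvol0 : (∫ x in a t..b t, pt1 h x t) = 0 := by
    have h1 : HasDerivAt (fun s => ∫ x in a s..b s, (h x s - w x)) 0 t := by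
      have : (fun s => ∫ x in a s..b s, (h x s - w x))
          = fun _ => ∫ x in a t..b t, (h x t - w x) := by
        funext s; exact hvol s t
      rw [this]; exact hasDerivAt_const _ _
    have h2 := L4.unique h1
    rw [(hpin t).1, (hpin t).2] at h2
    linarith
  have hinner : ∀ x s, (∫ y in w x..h x s, (y * Real.cos θ₀ + x * Real.sin θ₀))
      = (h x s ^ 2 - w x ^ 2) / 2 * Real.cos θ₀ + (h x s - w x) * (x * Real.sin θ₀) := by
    intro x s
    rw [intervalIntegral.integral_add (Continuous.intervalIntegrable (by fun_prop) _ _)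
      (Continuous.intervalIntegrable (by fun_prop) _ _)]
    simp
    ring
  simp only [hinner]
  have LF := (L1.add (L2.const_mul (γSL - γSG))).add (L3.const_mul κ)
  refine HasDerivAt.congr_deriv LF ?_
  -- the flux
  set G' : ℝ → ℝ := fun x => f1 x t + κ * f3 x t
    + β * (pt1 h x t ^ 2 / Real.sqrt (1 + px1 h x t ^ 2))
    + D * (deriv (deriv e) (c x t) * px1 c x t ^ 2 / Real.sqrt (1 + px1 h x t ^ 2))
    - lam t * pt1 h x t with hG'
  have cI1 : Continuous (fun x => f1 x t) := sl cf1
  have cI3 : Continuous (fun x => f3 x t) := sl cf3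
  have cIb : Continuous (fun x => pt1 h x t ^ 2 / Real.sqrt (1 + px1 h x t ^ 2)) :=
    ((sl cht).pow 2).div (sl cQ) (fun x => hQ0 x t)
  have cID : Continuous (fun x =>
      deriv (deriv e) (c x t) * px1 c x t ^ 2 / Real.sqrt (1 + px1 h x t ^ 2)) :=
    ((he2c.comp (sl cc)).mul ((sl ccx).pow 2)).div (sl cQ) (fun x => hQ0 x t)
  have cIt : Continuous (fun x => pt1 h x t) := sl cht
  have cG' : Continuous G' :=
    ((((cI1.add (cI3.const_mul κ)).add (cIb.const_mul β)).add (cID.const_mul D)).sub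
      (cIt.const_mul (lam t)))
  have hG : ∀ x ∈ Set.uIcc (a t) (b t), HasDerivAt
      (fun x => e (c x t) * px1 h x t * pt1 h x t / Qarc h x t
        + D * (deriv e (c x t) * px1 c x t / Qarc h x t)) (G' x) x := by
    intro x hx
    rw [Set.uIcc_of_le (hab t).le] at hx
    have d1 := (hed _).hasDerivAt.comp x (hc'.hasX x t)
    have d2 := (he1d _).hasDerivAt.comp x (hc'.hasX x t)
    have dp : HasDerivAt (fun x' => px1 h x' t) (pxx1 h x t) x := hh'.px.hasX x t
    have dQ := Q_x hh' x t
    have dcx := hc'.px.hasX x t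
    have D1 := (((d1.mul dp).mul (hh'.pt.hasX x t)).div dQ (hQ0 x t)).add
      (((d2.mul dcx).div dQ (hQ0 x t)).const_mul D)
    refine HasDerivAt.congr_deriv D1 ?_
    have E1 : px1 (fun x t => c x t * px1 h x t / Qarc h x t) x t = _ :=
      (((hc'.hasX x t).mul dp).div dQ (hQ0 x t)).deriv
    have E2 : px1 (fun x t => px1 c x t / Qarc h x t) x t = _ :=
      (dcx.div dQ (hQ0 x t)).deriv
    have hE := heq t x hx
    rw [E1, E2] at hE
    simp only [Pi.mul_apply] at hE
    have hM := hmot t x hx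
    have hq := Qarc_sq h x t
    have hq0 := hQ0 x t
    unfold curv at hM
    simp only [hG', hf1, hf3, Function.comp, Pi.mul_apply]
    change _ = _ + β * (pt1 h x t ^ 2 / Qarc h x t)
      + D * (deriv (deriv e) (c x t) * px1 c x t ^ 2 / Qarc h x t) - _
    generalize Qarc h x t = q at *
    generalize px1 (pt1 h) x t = htx at *
    generalize px1 (px1 c) x t = cxx at *
    generalize px1 c x t = cx at *
    generalize pt1 c x t = ct at *
    generalize pt1 h x t = ht at *
    generalize pxx1 h x t = pxx at *
    generalize px1 h x t = p at *
    generalize e (c x t) = e0 at *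
    generalize deriv (deriv e) (c x t) = e2 at *
    generalize deriv e (c x t) = e1 at *
    generalize c x t = c0 at *
    linear_combination (norm := (field_simp; ring)) -e1 * q * hE - ht * hM
      + (e0 - e1 * c0) * pxx * ht / q ^ 3 * hq
  have hFTC := intervalIntegral.integral_eq_sub_of_hasDerivAt hG (cG'.intervalIntegrable _ _)
  have hsplit : (∫ x in a t..b t, G' x) = (∫ x in a t..b t, f1 x t)
      + κ * (∫ x in a t..b t, f3 x t)
      + β * (∫ x in a t..b t, pt1 h x t ^ 2 / Real.sqrt (1 + px1 h x t ^ 2))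
      + D * (∫ x in a t..b t,
          deriv (deriv e) (c x t) * px1 c x t ^ 2 / Real.sqrt (1 + px1 h x t ^ 2))
      - lam t * (∫ x in a t..b t, pt1 h x t) := by
    simp only [hG']
    rw [intervalIntegral.integral_sub, intervalIntegral.integral_add,
      intervalIntegral.integral_add, intervalIntegral.integral_add]
    · simp only [intervalIntegral.integral_const_mul]
    all_goals exact Continuous.intervalIntegrable (by fun_prop) _ _
  rw [hsplit, hvol0] at hFTC
  have pb := hh'.pin w b hwd hbd (fun t => (hpin t).2) t
  have pa := hh'.pin w a hwd had (fun t => (hpin t).1) t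
  have key : ∀ q p c0 cx e0 e1 w1 v ht : ℝ, q ≠ 0 → q ^ 2 = 1 + p ^ 2 →
      ht = (w1 - p) * v → D * cx + c0 * (1 + p * w1) * v = 0 →
      e0 * p * ht / q + D * (e1 * cx / q) + e0 * q * v
        = (e0 - c0 * e1) * (1 + p * w1) / q * v := by
    intro q p c0 cx e0 e1 w1 v ht hq0 hq h1 h2
    subst h1
    field_simp
    linear_combination e1 * h2 + e0 * v * hq
  have kb := key _ _ _ _ (e (c (b t) t)) (deriv e (c (b t) t)) _ _ _ (hQ0 (b t) t)
    (Qarc_sq h (b t) t) pb (hbcb t)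
  have ka := key _ _ _ _ (e (c (a t) t)) (deriv e (c (a t) t)) _ _ _ (hQ0 (a t) t)
    (Qarc_sq h (a t) t) pa (hbca t)
  have cb := hclb t
  have ca := hcla t
  rw [(hpin t).1, (hpin t).2]
  simp only [intervalIntegral.integral_zero]
  linear_combination hFTC + kb - ka + deriv b t * cb + deriv a t * ca
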